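/- For integers k_1, ..., k_r ≥ 1 with k_r ≥ 2 and weight N = k_1 + ... + k_r, the multiple zeta value ζ(k_1,...,k_r) = Σ_{0<n_1<...<n_r} 1/(n_1^{k_1}⋯n_r^{k_r}) equals the iterated integral ∫_{0<t_1<...<t_N<1} ω_1(t_1)⋯ω_N(t_N), where ω_i(t) = dt/(1-t) if i ∈ {1, k_1+1, k_1+k_2+1, ..., k_1+...+k_{r-1}+1} and ω_i(t) = dt/t otherwise. -/

import Mathlib

open MeasureTheory

noncomputable section MZV

open scoped Classical in
/-- the density of the form at position `i` -/
def mzvForm (P : ℕ → Prop) (i : ℕ) (s : ℝ) : ENNReal :=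
  ENNReal.ofReal (if P i then (1 - s)⁻¹ else s⁻¹)

def mzvSimplex (N : ℕ) (x : ℝ) : Set (Fin N → ℝ) :=
  {t | (∀ i j : Fin N, i < j → t i < t j) ∧ ∀ i, 0 < t i ∧ t i < x}

def mzvInt (P : ℕ → Prop) (N : ℕ) (x : ℝ) : ENNReal :=
  ∫⁻ t in mzvSimplex N x, ∏ i : Fin N, mzvForm P i (t i)

open scoped Classical in
def mzvCoef (P : ℕ → Prop) : ℕ → ℕ → ENNReal
  | 0, n => if n = 0 then 1 else 0
  | N + 1, n => if P N then (∑ m ∈ Finset.range n, mzvCoef P N m) * (n : ENNReal)⁻¹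
      else mzvCoef P N n * (n : ENNReal)⁻¹

lemma measurable_mzvForm (P : ℕ → Prop) (i : ℕ) : Measurable (mzvForm P i) := by
  unfold mzvForm
  by_cases h : P i <;> simp only [h, if_true, if_false] <;> fun_prop

lemma measurableSet_mzvSimplex (N : ℕ) (x : ℝ) : MeasurableSet (mzvSimplex N x) := by
  have : mzvSimplex N x = (⋂ i : Fin N, ⋂ j : Fin N, ⋂ _ : i < j, {t | t i < t j}) ∩
      ⋂ i : Fin N, ({t | 0 < t i} ∩ {t | t i < x}) := by
    ext t; simp [mzvSimplex]
  rw [this]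
  refine MeasurableSet.inter ?_ ?_
  · refine MeasurableSet.iInter fun i => MeasurableSet.iInter fun j => MeasurableSet.iInter fun _ =>
      measurableSet_lt (by fun_prop) (by fun_prop)
  · exact MeasurableSet.iInter fun i => (measurableSet_lt (by fun_prop) (by fun_prop)).inter
      (measurableSet_lt (by fun_prop) (by fun_prop))

lemma snoc_mem_mzvSimplex (N : ℕ) (x s : ℝ) (u : Fin N → ℝ) :
    (Fin.snoc u s : Fin (N+1) → ℝ) ∈ mzvSimplex (N+1) x ↔ s ∈ Set.Ioo 0 x ∧ u ∈ mzvSimplex N s := by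
  simp only [mzvSimplex, Set.mem_ofPred_eq, Set.mem_Ioo]
  constructor
  · rintro ⟨h1, h2⟩
    refine ⟨by simpa using h2 (Fin.last N), fun i j hij => ?_, fun i => ⟨?_, ?_⟩⟩
    · simpa using h1 i.castSucc j.castSucc (by simpa using hij)
    · simpa using (h2 i.castSucc).1
    · simpa using h1 i.castSucc (Fin.last N) (Fin.castSucc_lt_last i)
  · rintro ⟨h1, h2, h3⟩
    refine ⟨fun i j hij => ?_, fun i => ?_⟩
    · induction j using Fin.lastCases with
      | last =>
        induction i using Fin.lastCases with
        | last => exact absurd hij (lt_irrefl _)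
        | cast i => simpa using (h3 i).2
      | cast j =>
        induction i using Fin.lastCases with
        | last => exact absurd hij (not_lt.2 (Fin.le_last _))
        | cast i => simpa using h2 i j (by simpa using hij)
    · induction i using Fin.lastCases with
      | last => simpa using h1
      | cast i => simpa using ⟨(h3 i).1, (h3 i).2.trans h1.2⟩

lemma mzvInt_succ (P : ℕ → Prop) (N : ℕ) (x : ℝ) :
    mzvInt P (N+1) x = ∫⁻ s in Set.Ioo 0 x, mzvForm P N s * mzvInt P N s := by
  have hmeas : ∀ N, Measurable (fun t : Fin N → ℝ => ∏ i : Fin N, mzvForm P i (t i)) := fun N =>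
    Finset.measurable_prod _ fun i _ => (measurable_mzvForm P i).comp (measurable_pi_apply i)
  have hp := (volume_preserving_piFinSuccAbove (fun _ : Fin (N+1) => ℝ) (Fin.last N)).symm
  unfold mzvInt
  rw [← lintegral_indicator (measurableSet_mzvSimplex _ _),
    ← hp.lintegral_comp_emb (MeasurableEquiv.measurableEmbedding _), Measure.volume_eq_prod,
    lintegral_prod, ← lintegral_indicator measurableSet_Ioo]
  · refine lintegral_congr fun s => ?_
    have key : ∀ u : Fin N → ℝ, ((mzvSimplex (N+1) x).indicator
        (fun t => ∏ i : Fin (N+1), mzvForm P i (t i)))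
        ((MeasurableEquiv.piFinSuccAbove (fun _ : Fin (N+1) => ℝ) (Fin.last N)).symm (s, u))
        = (Set.Ioo 0 x).indicator (mzvForm P N) s *
          (mzvSimplex N s).indicator (fun t => ∏ i : Fin N, mzvForm P i (t i)) u := by
      intro u
      have h0 : (MeasurableEquiv.piFinSuccAbove (fun _ : Fin (N+1) => ℝ) (Fin.last N)).symm (s, u)
          = (Fin.snoc u s : Fin (N+1) → ℝ) := by
        simp [MeasurableEquiv.piFinSuccAbove, Fin.insertNthEquiv, Fin.insertNth_last']
      rw [h0]
      have h1 := snoc_mem_mzvSimplex N x s u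
      by_cases ha : s ∈ Set.Ioo 0 x <;> by_cases hb : u ∈ mzvSimplex N s
      · rw [Set.indicator_of_mem (h1.2 ⟨ha, hb⟩), Set.indicator_of_mem ha, Set.indicator_of_mem hb,
          Fin.prod_univ_castSucc]
        simp [mul_comm]
      all_goals
        rw [Set.indicator_of_notMem (fun h => by have := h1.1 h; tauto)]
        simp [ha, hb]
    simp_rw [key]
    rw [lintegral_const_mul _ ((hmeas N).indicator (measurableSet_mzvSimplex _ _)),
      lintegral_indicator (measurableSet_mzvSimplex _ _)]
    by_cases ha : s ∈ Set.Ioo 0 x <;> simp [ha]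
  · exact (((hmeas _).indicator (measurableSet_mzvSimplex _ _)).comp
      (MeasurableEquiv.measurable _)).aemeasurable

lemma lintegral_pow_Ioo (n : ℕ) (x : ℝ) (hx : 0 ≤ x) :
    ∫⁻ s in Set.Ioo 0 x, ENNReal.ofReal s ^ n
      = ENNReal.ofReal x ^ (n+1) * ((n + 1 : ℕ) : ENNReal)⁻¹ := by
  have h1 : ∫⁻ s in Set.Ioo 0 x, ENNReal.ofReal s ^ n
      = ∫⁻ s in Set.Ioo 0 x, ENNReal.ofReal (s ^ n) := by
    refine setLIntegral_congr_fun measurableSet_Ioo fun s hs => ?_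
    simp only [ENNReal.ofReal_pow hs.1.le]
  rw [h1, ← ofReal_integral_eq_lintegral_ofReal]
  · rw [← integral_Ioc_eq_integral_Ioo, ← intervalIntegral.integral_of_le hx, integral_pow,
      ← ENNReal.ofReal_pow hx, ← ENNReal.ofReal_natCast, ← ENNReal.ofReal_inv_of_pos (by positivity),
      ← ENNReal.ofReal_mul (by positivity)]
    simp [div_eq_mul_inv]
  · exact ((continuous_pow n).integrableOn_Icc (a := 0) (b := x)).mono_set Set.Ioo_subset_Icc_self
  · refine (ae_restrict_iff' measurableSet_Ioo).2 (Filter.Eventually.of_forall fun s hs => ?_)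
    exact pow_nonneg hs.1.le n

lemma tsum_if_lt (g : ℕ → ENNReal) (m : ℕ) :
    ∑' n, (if m < n then g n else 0) = ∑' j, g (j + (m + 1)) := by
  rw [← Summable.sum_add_tsum_nat_add' (k := m + 1) ENNReal.summable]
  rw [Finset.sum_eq_zero, zero_add]
  · refine tsum_congr fun j => ?_
    rw [if_pos (by omega)]
  · intro i hi
    rw [if_neg (by simp at hi; omega)]

lemma mzvCoef_zero (P : ℕ → Prop) (h0 : P 0) (N : ℕ) : mzvCoef P (N+1) 0 = 0 := by
  induction N with
  | zero => simp [mzvCoef, h0]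
  | succ N ih =>
    rw [mzvCoef]
    split_ifs
    · simp
    · rw [ih]; simp

lemma mzvInt_eq (P : ℕ → Prop) (h0 : P 0) (N : ℕ) : ∀ x : ℝ, 0 < x → x ≤ 1 →
    mzvInt P N x = ∑' n, mzvCoef P N n * ENNReal.ofReal x ^ n := by
  induction N with
  | zero =>
    intro x _ _
    rw [tsum_eq_single 0 (by intro n hn; simp [mzvCoef, hn])]
    have : mzvSimplex 0 x = Set.univ := by ext t; simp [mzvSimplex]
    have hv : (volume : Measure (Fin 0 → ℝ)) Set.univ = 1 := by
      rw [volume_pi, Measure.pi_of_empty _ default]; simp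
    simp [mzvInt, mzvCoef, this, hv]
  | succ N ih =>
    intro x hx hx1
    rw [mzvInt_succ]
    by_cases hP : P N
    · have e1 : ∫⁻ s in Set.Ioo 0 x, mzvForm P N s * mzvInt P N s
          = ∫⁻ s in Set.Ioo 0 x, ∑' m, ∑' j, mzvCoef P N m * ENNReal.ofReal s ^ (j + m) := by
        refine setLIntegral_congr_fun measurableSet_Ioo fun s hs => ?_
        have hs1 : s < 1 := hs.2.trans_le hx1
        rw [ih s hs.1 hs1.le, ← ENNReal.tsum_mul_left]
        refine tsum_congr fun m => ?_
        have : mzvForm P N s = ∑' j, ENNReal.ofReal s ^ j := by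
          rw [ENNReal.tsum_geometric, mzvForm, if_pos hP,
            ENNReal.ofReal_inv_of_pos (by linarith), ENNReal.ofReal_sub _ hs.1.le,
            ENNReal.ofReal_one]
        rw [this, ← ENNReal.tsum_mul_right]
        refine tsum_congr fun j => ?_
        rw [pow_add]; ring
      rw [e1, lintegral_tsum (fun m => by fun_prop)]
      have e2 : ∀ m, ∫⁻ s in Set.Ioo 0 x, ∑' j, mzvCoef P N m * ENNReal.ofReal s ^ (j + m)
          = ∑' n, if m < n then mzvCoef P N m * (ENNReal.ofReal x ^ n * (n : ENNReal)⁻¹) else 0 := by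
        intro m
        rw [lintegral_tsum (fun m => by fun_prop), tsum_if_lt]
        refine tsum_congr fun j => ?_
        rw [lintegral_const_mul _ (by fun_prop), lintegral_pow_Ioo _ _ hx.le]
        rfl
      simp_rw [e2]
      rw [ENNReal.tsum_comm]
      refine tsum_congr fun n => ?_
      rw [tsum_eq_sum (s := Finset.range n) (by intro b hb; simp at hb; simp [hb]), mzvCoef,
        if_pos hP, Finset.sum_mul, Finset.sum_mul]
      refine Finset.sum_congr rfl fun m hm => ?_
      rw [if_pos (by simpa using hm)]; ring
    · obtain ⟨M, rfl⟩ : ∃ M, N = M + 1 :=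
        Nat.exists_eq_succ_of_ne_zero (by rintro rfl; exact hP h0)
      have e1 : ∫⁻ s in Set.Ioo 0 x, mzvForm P (M+1) s * mzvInt P (M+1) s
          = ∫⁻ s in Set.Ioo 0 x, ∑' m, mzvCoef P (M+1) m * ENNReal.ofReal s ^ (m - 1) := by
        refine setLIntegral_congr_fun measurableSet_Ioo fun s hs => ?_
        have hs1 : s < 1 := hs.2.trans_le hx1
        rw [ih s hs.1 hs1.le, ← ENNReal.tsum_mul_left]
        refine tsum_congr fun m => ?_
        cases m with
        | zero => simp [mzvCoef_zero P h0]
        | succ m =>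
          have : mzvForm P (M+1) s * ENNReal.ofReal s = 1 := by
            rw [mzvForm, if_neg hP, ENNReal.ofReal_inv_of_pos hs.1]
            exact ENNReal.inv_mul_cancel (by simpa using hs.1) ENNReal.ofReal_ne_top
          calc _ = mzvCoef P (M+1) (m+1) * ENNReal.ofReal s ^ m *
                (mzvForm P (M+1) s * ENNReal.ofReal s) := by ring
            _ = _ := by rw [this]; simp
      rw [e1, lintegral_tsum (fun m => by fun_prop)]
      refine tsum_congr fun n => ?_
      rw [lintegral_const_mul _ (by fun_prop), lintegral_pow_Ioo _ _ hx.le]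
      cases n with
      | zero => simp [mzvCoef_zero P h0]
      | succ n =>
        conv_rhs => rw [mzvCoef, if_neg hP]
        simp only [Nat.add_sub_cancel]
        ring

/-- inner sums -/
def mzvZ (K : ℕ → ℕ) : ℕ → ℕ → ENNReal
  | 0, n => if n = 0 then 1 else 0
  | s + 1, n => (∑ m ∈ Finset.range n, mzvZ K s m) * (n : ENNReal)⁻¹ ^ K s

lemma mzvCoef_eq (K : ℕ → ℕ) (hK : ∀ i, 1 ≤ K i) (P : ℕ → Prop)
    (r : ℕ) (hP : ∀ i < ∑ j ∈ Finset.range r, K j, P i ↔ ∃ s < r, i = ∑ j ∈ Finset.range s, K j) :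
    ∀ s ≤ r, ∀ n, mzvCoef P (∑ j ∈ Finset.range s, K j) n = mzvZ K s n := by
  have hS : StrictMono (fun s => ∑ j ∈ Finset.range s, K j) :=
    strictMono_nat_of_lt_succ fun s => by
      simp only [Finset.sum_range_succ]; have := hK s; omega
  intro s
  induction s with
  | zero => intro _ n; simp [mzvCoef, mzvZ]
  | succ s ih =>
    intro hs n
    have h1 : ∀ j, j + 1 ≤ K s → mzvCoef P (∑ j ∈ Finset.range s, K j + (j + 1)) n
        = (∑ m ∈ Finset.range n, mzvZ K s m) * (n : ENNReal)⁻¹ ^ (j + 1) := by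
      intro j
      have hlt : ∀ j, j + 1 ≤ K s → ∑ j ∈ Finset.range s, K j + j < ∑ j ∈ Finset.range r, K j := by
        intro j hj
        have := hS.monotone hs
        simp only [Finset.sum_range_succ] at this
        omega
      induction j with
      | zero =>
        intro hj
        have hp : P (∑ j ∈ Finset.range s, K j) := (hP _ (hlt 0 hj)).2 ⟨s, hs, rfl⟩
        rw [zero_add, mzvCoef, if_pos hp, pow_one]
        congr 1
        exact Finset.sum_congr rfl fun m _ => ih (by omega) m
      | succ j ihj =>
        intro hj
        have hp : ¬ P (∑ j ∈ Finset.range s, K j + (j + 1)) := by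
          rw [hP _ (hlt _ hj)]
          rintro ⟨s', hs', h⟩
          have h2 : s < s' := hS.lt_iff_lt.1 (by omega)
          have h3 : s' < s + 1 := hS.lt_iff_lt.1 (by simp only [Finset.sum_range_succ]; omega)
          omega
        rw [← add_assoc, mzvCoef, if_neg hp, ihj (by omega), pow_succ _ (j + 1), mul_assoc]
    have := h1 (K s - 1) (by have := hK s; omega)
    rw [Nat.sub_add_cancel (hK s)] at this
    rw [Finset.sum_range_succ, this, mzvZ]

def mzvSet (r : ℕ) (M : WithTop ℕ) : Set (Fin r → ℕ+) :=
  {n | StrictMono n ∧ ∀ i, (((n i : ℕ)) : WithTop ℕ) < M}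

lemma snoc_mem_mzvSet (r : ℕ) (M : WithTop ℕ) (s : ℕ+) (u : Fin r → ℕ+) :
    (Fin.snoc u s : Fin (r+1) → ℕ+) ∈ mzvSet (r+1) M ↔
      ((s : ℕ) : WithTop ℕ) < M ∧ u ∈ mzvSet r (s : ℕ) := by
  simp only [mzvSet, Set.mem_ofPred_eq]
  constructor
  · rintro ⟨h1, h2⟩
    refine ⟨by simpa using h2 (Fin.last r), fun i j hij => ?_, fun i => ?_⟩
    · simpa using @h1 i.castSucc j.castSucc (by simpa using hij)
    · have := @h1 i.castSucc (Fin.last r) (Fin.castSucc_lt_last i)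
      simp only [Fin.snoc_castSucc, Fin.snoc_last] at this
      exact_mod_cast this
  · rintro ⟨h1, h2, h3⟩
    refine ⟨fun i j hij => ?_, fun i => ?_⟩
    · induction j using Fin.lastCases with
      | last =>
        induction i using Fin.lastCases with
        | last => exact absurd hij (lt_irrefl _)
        | cast i =>
          have := h3 i
          simp only [Fin.snoc_castSucc, Fin.snoc_last]
          exact_mod_cast this
      | cast j =>
        induction i using Fin.lastCases with
        | last => exact absurd hij (not_lt.2 (Fin.le_last _))
        | cast i => simpa using @h2 i j (by simpa using hij)
    · induction i using Fin.lastCases with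
      | last => simpa using h1
      | cast i => simpa using (h3 i).trans h1

def mzvH (K : ℕ → ℕ) (r : ℕ) (M : WithTop ℕ) : ENNReal :=
  ∑' n : Fin r → ℕ+, (mzvSet r M).indicator
    (fun n => ∏ i : Fin r, ((n i : ℕ) : ENNReal)⁻¹ ^ K i) n

open scoped Classical in
lemma mzvH_succ (K : ℕ → ℕ) (r : ℕ) (M : WithTop ℕ) :
    mzvH K (r+1) M = ∑' m : ℕ+, if ((m : ℕ) : WithTop ℕ) < M then
      mzvH K r (m : ℕ) * ((m : ℕ) : ENNReal)⁻¹ ^ K r else 0 := by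
  unfold mzvH
  rw [← (Fin.snocEquiv (fun _ : Fin (r+1) => ℕ+)).tsum_eq, ENNReal.tsum_prod']
  refine tsum_congr fun s => ?_
  have key : ∀ u : Fin r → ℕ+, (mzvSet (r+1) M).indicator
      (fun n => ∏ i : Fin (r+1), ((n i : ℕ) : ENNReal)⁻¹ ^ K i)
      (Fin.snocEquiv (fun _ : Fin (r+1) => ℕ+) (s, u)) =
      if ((s : ℕ) : WithTop ℕ) < M then (mzvSet r (s : ℕ)).indicator
        (fun n => ∏ i : Fin r, ((n i : ℕ) : ENNReal)⁻¹ ^ K i) u * ((s : ℕ) : ENNReal)⁻¹ ^ K r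
      else 0 := by
    intro u
    have h0 : Fin.snocEquiv (fun _ : Fin (r+1) => ℕ+) (s, u) = (Fin.snoc u s : Fin (r+1) → ℕ+) := rfl
    rw [h0]
    have h1 := snoc_mem_mzvSet r M s u
    by_cases ha : ((s : ℕ) : WithTop ℕ) < M <;> by_cases hb : u ∈ mzvSet r (s : ℕ)
    · rw [Set.indicator_of_mem (h1.2 ⟨ha, hb⟩), if_pos ha, Set.indicator_of_mem hb,
        Fin.prod_univ_castSucc]
      simp
    all_goals
      rw [Set.indicator_of_notMem (fun h => by have := h1.1 h; tauto)]
      simp [ha, hb]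
  simp_rw [key]
  split_ifs
  · rw [ENNReal.tsum_mul_right]
  · simp

open scoped Classical in
lemma mzvH_succ_eq (K : ℕ → ℕ) (r : ℕ)
    (ih : ∀ M : ℕ, 1 ≤ M → mzvH K r M = ∑ m ∈ Finset.range M, mzvZ K r m) (M : WithTop ℕ) :
    mzvH K (r+1) M = ∑' m : ℕ, if (m : WithTop ℕ) < M then mzvZ K (r+1) m else 0 := by
  have h : ∑' m : ℕ+, (fun m : ℕ => if (m : WithTop ℕ) < M then mzvZ K (r+1) m else 0) (m : ℕ)
      = ∑' m : ℕ, if (m : WithTop ℕ) < M then mzvZ K (r+1) m else 0 := by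
    refine PNat.coe_injective.tsum_eq
      (f := fun m : ℕ => if (m : WithTop ℕ) < M then mzvZ K (r+1) m else 0) fun m hm => ?_
    rcases Nat.eq_zero_or_pos m with rfl | h
    · exact absurd (by simp [mzvZ]) hm
    · exact ⟨⟨m, h⟩, rfl⟩
  rw [← h, mzvH_succ]
  refine tsum_congr fun m => ?_
  simp only [mzvZ, ih m m.2]

lemma mzvH_nat (K : ℕ → ℕ) (r : ℕ) : ∀ M : ℕ, 1 ≤ M →
    mzvH K r M = ∑ m ∈ Finset.range M, mzvZ K r m := by
  induction r with
  | zero =>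
    intro M hM
    have : (default : Fin 0 → ℕ+) ∈ mzvSet 0 (M : WithTop ℕ) :=
      ⟨Subsingleton.strictMono _, fun i => i.elim0⟩
    simp only [mzvZ, Finset.sum_ite_eq', Finset.mem_range]
    rw [if_pos (by omega), mzvH, tsum_eq_single default (fun b hb => absurd (Subsingleton.elim _ _) hb),
      Set.indicator_of_mem this]
    simp
  | succ r ih =>
    intro M hM
    rw [mzvH_succ_eq K r ih, tsum_eq_sum (s := Finset.range M)
      (by intro b hb; simp at hb; simp [hb])]
    refine Finset.sum_congr rfl fun m hm => ?_
    rw [if_pos (by simpa using hm)]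

lemma mzvH_top (K : ℕ → ℕ) (r : ℕ) : mzvH K (r+1) ⊤ = ∑' m, mzvZ K (r+1) m := by
  rw [mzvH_succ_eq K r (mzvH_nat K r)]
  refine tsum_congr fun m => ?_
  rw [if_pos (by simp)]

end MZV

/-- The multiple zeta value ζ(k₁,…,k_r) equals its iterated-integral
(Kontsevich–Drinfeld) representation over the open simplex 0 < t₁ < ⋯ < t_N < 1,
where N = k₁+⋯+k_r, with form dt/(1-t) at positions 1, k₁+1, …, k₁+⋯+k_{r-1}+1
and dt/t elsewhere. -/
theorem stmt_11 (r : ℕ) (hr : 1 ≤ r) (k : Fin r → ℕ) (hk : ∀ i, 1 ≤ k i)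
    (hlast : 2 ≤ k ⟨r - 1, by omega⟩) :
    (∑' n : {n : Fin r → ℕ+ // StrictMono n}, ∏ i, ((n.1 i : ℝ))⁻¹ ^ (k i))
      = ∫ t in {t : Fin (∑ i, k i) → ℝ |
            (∀ i j : Fin (∑ i, k i), i < j → t i < t j) ∧
            ∀ i, 0 < t i ∧ t i < 1},
          ∏ i : Fin (∑ i, k i),
            (if ∃ s : Fin r, (i : ℕ) = ∑ j ∈ Finset.univ.filter (fun j => j < s), k j
              then (1 - t i)⁻¹ else (t i)⁻¹) := by
  set K : ℕ → ℕ := fun i => if h : i < r then k ⟨i, h⟩ else 1 with hKdef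
  have hKk : ∀ i : Fin r, K i = k i := fun i => by simp [hKdef]
  have hK : ∀ i, 1 ≤ K i := by
    intro i
    simp only [hKdef]
    split_ifs
    · exact hk _
    · exact le_rfl
  have hsum : ∑ i, k i = ∑ j ∈ Finset.range r, K j := by
    rw [Finset.sum_range]; exact Finset.sum_congr rfl fun i _ => (hKk i).symm
  have hpart : ∀ s : Fin r, ∑ j ∈ Finset.univ.filter (fun j => j < s), k j
      = ∑ j ∈ Finset.range (s : ℕ), K j := by
    intro s
    refine Finset.sum_bij (fun j _ => (j : ℕ)) ?_ ?_ ?_ ?_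
    · intro j hj; simpa using hj
    · intro a _ b _ h; exact Fin.ext h
    · intro b hb
      have hb' : b < (s : ℕ) := by simpa using hb
      exact ⟨⟨b, hb'.trans s.2⟩, Finset.mem_filter.2 ⟨Finset.mem_univ _, hb'⟩, rfl⟩
    · intro j _; exact (hKk j).symm
  set P : ℕ → Prop := fun i => ∃ s : Fin r, i = ∑ j ∈ Finset.univ.filter (fun j => j < s), k j
    with hPdef
  have hP : ∀ i, P i ↔ ∃ s < r, i = ∑ j ∈ Finset.range s, K j := by
    intro i
    simp only [hPdef, hpart]
    constructor
    · rintro ⟨s, h⟩; exact ⟨s, s.2, h⟩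
    · rintro ⟨s, h1, h2⟩; exact ⟨⟨s, h1⟩, h2⟩
  have hP0 : P 0 := (hP 0).2 ⟨0, hr, by simp⟩
  have hI : mzvInt P (∑ i, k i) 1 = mzvH K r ⊤ := by
    rw [mzvInt_eq P hP0 _ 1 one_pos le_rfl, hsum]
    obtain ⟨r', rfl⟩ : ∃ r', r = r' + 1 := ⟨r - 1, by omega⟩
    rw [mzvH_top]
    refine tsum_congr fun n => ?_
    rw [mzvCoef_eq K hK P (r' + 1) (fun i _ => hP i) _ le_rfl]
    simp
  have hL : (∑' n : {n : Fin r → ℕ+ // StrictMono n}, ∏ i, ((n.1 i : ℝ))⁻¹ ^ (k i))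
      = (mzvH K r ⊤).toReal := by
    have hset : mzvSet r ⊤ = {n : Fin r → ℕ+ | StrictMono n} := by
      ext n; simp [mzvSet]
    rw [mzvH, ← tsum_subtype, ENNReal.tsum_toReal_eq, hset]
    · refine tsum_congr fun n => ?_
      rw [ENNReal.toReal_prod]
      refine Finset.prod_congr rfl fun i _ => ?_
      simp [hKk]
    · intro n
      refine ENNReal.prod_ne_top fun i _ => ENNReal.pow_ne_top ?_
      simp
  have hms := measurableSet_mzvSimplex (∑ i, k i) 1
  rw [hL, ← hI]
  change _ = ∫ t in mzvSimplex (∑ i, k i) 1, _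
  rw [integral_eq_lintegral_of_nonneg_ae]
  · congr 1
    refine setLIntegral_congr_fun hms fun t ht => ?_
    rw [ENNReal.ofReal_prod_of_nonneg]
    · refine Finset.prod_congr rfl fun i _ => ?_
      simp only [mzvForm]
      congr 1
      by_cases h : P i
      · rw [if_pos h, if_pos h]
      · rw [if_neg h, if_neg h]
    · intro i _
      have := ht.2 i
      split_ifs
      · exact inv_nonneg.2 (by linarith)
      · exact inv_nonneg.2 this.1.le
  · refine (ae_restrict_iff' hms).2 (Filter.Eventually.of_forall fun t ht => ?_)
    refine Finset.prod_nonneg fun i _ => ?_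
    have := ht.2 i
    split_ifs
    · exact inv_nonneg.2 (by linarith)
    · exact inv_nonneg.2 this.1.le
  · refine (Finset.measurable_prod _ fun i _ => ?_).aestronglyMeasurable
    split_ifs
    · fun_prop
    · fun_prop
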